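/- arXiv:1911.05076 — 2 statements merged into one kernel-verified Lean document; each statement's English description precedes it below -/
import Mathlib

section
/- The gyration operator gyr[u,v]w := -(u ⊕_κ v) ⊕_κ (u ⊕_κ (v ⊕_κ w)) admits the closed form gyr[u,v]w = w + 2(Au + Bv)/D, where A = -κ²⟨u,w⟩‖v‖² - κ⟨v,w⟩ + 2κ²⟨u,v⟩⟨v,w⟩, B = -κ²⟨v,w⟩‖u‖² + κ⟨u,w⟩, and D = 1 - 2κ⟨u,v⟩ + κ²‖u‖²‖v‖². -/
open scoped RealInnerProductSpace

noncomputable def kdenom {n : ℕ} (κ : ℝ) (x y : EuclideanSpace ℝ (Fin n)) : ℝ :=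
  1 - 2 * κ * ⟪x, y⟫ + κ ^ 2 * ‖x‖ ^ 2 * ‖y‖ ^ 2

noncomputable def kadd {n : ℕ} (κ : ℝ) (x y : EuclideanSpace ℝ (Fin n)) :
    EuclideanSpace ℝ (Fin n) :=
  (kdenom κ x y)⁻¹ •
    ((1 - 2 * κ * ⟪x, y⟫ - κ * ‖y‖ ^ 2) • x + (1 + κ * ‖x‖ ^ 2) • y)

/-- The gyration operator. -/
noncomputable def kgyr {n : ℕ} (κ : ℝ) (u v w : EuclideanSpace ℝ (Fin n)) :
    EuclideanSpace ℝ (Fin n) :=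
  kadd κ (-(kadd κ u v)) (kadd κ u (kadd κ v w))

theorem norm_sq_kadd {n : ℕ} (κ : ℝ) (x y : EuclideanSpace ℝ (Fin n)) (h : kdenom κ x y ≠ 0) :
    ‖kadd κ x y‖ ^ 2 = (‖x‖ ^ 2 + 2 * ⟪x, y⟫ + ‖y‖ ^ 2) / kdenom κ x y := by
  rw [eq_div_iff h, kadd, norm_smul, mul_pow, norm_add_sq_real, norm_smul, norm_smul,
    real_inner_smul_left, real_inner_smul_right]
  simp only [mul_pow, Real.norm_eq_abs, sq_abs]
  field_simp
  unfold kdenom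
  ring

/-- Closed form of the gyration operator: `gyr[u,v]w = w + 2(Au + Bv)/D`. -/
theorem kgyr_closed_form {n : ℕ} (κ : ℝ) (u v w : EuclideanSpace ℝ (Fin n))
    (h₁ : kdenom κ u v ≠ 0) (h₂ : kdenom κ v w ≠ 0)
    (h₃ : kdenom κ u (kadd κ v w) ≠ 0)
    (h₄ : kdenom κ (-(kadd κ u v)) (kadd κ u (kadd κ v w)) ≠ 0) :
    kgyr κ u v w = w +
      (2 / (1 - 2 * κ * ⟪u, v⟫ + κ ^ 2 * ‖u‖ ^ 2 * ‖v‖ ^ 2)) •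
        ((-(κ ^ 2) * ⟪u, w⟫ * ‖v‖ ^ 2 - κ * ⟪v, w⟫
            + 2 * κ ^ 2 * ⟪u, v⟫ * ⟪v, w⟫) • u
          + (-(κ ^ 2) * ⟪v, w⟫ * ‖u‖ ^ 2 + κ * ⟪u, w⟫) • v) := by
  obtain ⟨D, hD⟩ : ∃ D, D = kdenom κ u v := ⟨_, rfl⟩
  obtain ⟨E, hE⟩ : ∃ E, E = kdenom κ v w := ⟨_, rfl⟩
  have hy := norm_sq_kadd κ v w h₂
  have ha := norm_sq_kadd κ u v h₁
  have hb := norm_sq_kadd κ u (kadd κ v w) h₃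
  have ha' : kadd κ u v = D⁻¹ • ((1 - 2 * κ * ⟪u, v⟫ - κ * ‖v‖ ^ 2) • u
      + (1 + κ * ‖u‖ ^ 2) • v) := by rw [hD, kadd]
  have hy' : kadd κ v w = E⁻¹ • ((1 - 2 * κ * ⟪v, w⟫ - κ * ‖w‖ ^ 2) • v
      + (1 + κ * ‖v‖ ^ 2) • w) := by rw [hE, kadd]
  have hb' : kadd κ u (kadd κ v w) = (kdenom κ u (kadd κ v w))⁻¹ •
      ((1 - 2 * κ * ⟪u, kadd κ v w⟫ - κ * ‖kadd κ v w‖ ^ 2) • u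
      + (1 + κ * ‖u‖ ^ 2) • kadd κ v w) := by rw [kadd]
  rw [← hD] at h₁ ha
  rw [← hE] at h₂ hy
  have hD' : 1 - 2 * κ * ⟪u, v⟫ + κ ^ 2 * ‖u‖ ^ 2 * ‖v‖ ^ 2 = D := by rw [hD, kdenom]
  have hE' : E = 1 - 2 * κ * ⟪v, w⟫ + κ ^ 2 * ‖v‖ ^ 2 * ‖w‖ ^ 2 := by rw [hE, kdenom]
  clear hD hE
  rw [hD']
  have hc : kdenom κ (-(kadd κ u v)) (kadd κ u (kadd κ v w)) = 1 + 2 * κ *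
      ⟪kadd κ u v, kadd κ u (kadd κ v w)⟫ + κ ^ 2 * ‖kadd κ u v‖ ^ 2 *
      ‖kadd κ u (kadd κ v w)‖ ^ 2 := by
    rw [kdenom, inner_neg_left, norm_neg]; ring
  have hg : kgyr κ u v w = (kdenom κ (-(kadd κ u v)) (kadd κ u (kadd κ v w)))⁻¹ •
      ((1 + 2 * κ * ⟪kadd κ u v, kadd κ u (kadd κ v w)⟫
        - κ * ‖kadd κ u (kadd κ v w)‖ ^ 2) • -(kadd κ u v)
      + (1 + κ * ‖kadd κ u v‖ ^ 2) • kadd κ u (kadd κ v w)) := by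
    rw [kgyr, kadd, inner_neg_left, norm_neg]
    congr 4; ring
  have hF : kdenom κ u (kadd κ v w) = 1 - 2 * κ * ⟪u, kadd κ v w⟫
      + κ ^ 2 * ‖u‖ ^ 2 * ‖kadd κ v w‖ ^ 2 := rfl
  have huy : ⟪u, kadd κ v w⟫ = ((1 - 2 * κ * ⟪v, w⟫ - κ * ‖w‖ ^ 2) * ⟪u, v⟫
      + (1 + κ * ‖v‖ ^ 2) * ⟪u, w⟫) / E := by
    rw [hy', real_inner_smul_right, inner_add_right, real_inner_smul_right,
      real_inner_smul_right]
    ring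
  have hvy : ⟪v, kadd κ v w⟫ = ((1 - 2 * κ * ⟪v, w⟫ - κ * ‖w‖ ^ 2) * ‖v‖ ^ 2
      + (1 + κ * ‖v‖ ^ 2) * ⟪v, w⟫) / E := by
    rw [hy', real_inner_smul_right, inner_add_right, real_inner_smul_right,
      real_inner_smul_right, real_inner_self_eq_norm_sq]
    ring
  have hab : ⟪kadd κ u v, kadd κ u (kadd κ v w)⟫ =
      ((1 - 2 * κ * ⟪u, v⟫ - κ * ‖v‖ ^ 2) *
        ((1 - 2 * κ * ⟪u, kadd κ v w⟫ - κ * ‖kadd κ v w‖ ^ 2) * ‖u‖ ^ 2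
          + (1 + κ * ‖u‖ ^ 2) * ⟪u, kadd κ v w⟫)
      + (1 + κ * ‖u‖ ^ 2) *
        ((1 - 2 * κ * ⟪u, kadd κ v w⟫ - κ * ‖kadd κ v w‖ ^ 2) * ⟪u, v⟫
          + (1 + κ * ‖u‖ ^ 2) * ⟪v, kadd κ v w⟫)) / (D * kdenom κ u (kadd κ v w)) := by
    rw [ha', hb']
    simp only [real_inner_smul_left, real_inner_smul_right, inner_add_left, inner_add_right,
      real_inner_self_eq_norm_sq, real_inner_comm u v]
    field_simp
    ring
  generalize hFd : kdenom κ u (kadd κ v w) = F at *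
  generalize hGd : kdenom κ (-(kadd κ u v)) (kadd κ u (kadd κ v w)) = G at *
  rw [hg]
  generalize ⟪kadd κ u v, kadd κ u (kadd κ v w)⟫ = ab at *
  generalize ‖kadd κ u (kadd κ v w)‖ ^ 2 = bb at *
  generalize ‖kadd κ u v‖ ^ 2 = aa at *
  rw [hb', ha']
  generalize ⟪u, kadd κ v w⟫ = uy at *
  generalize ⟪v, kadd κ v w⟫ = vy at *
  generalize ‖kadd κ v w‖ ^ 2 = yy at *
  rw [hy']
  clear hg hb' ha' hy' hFd hGd
  generalize ⟪u, v⟫ = uv at *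
  generalize ⟪u, w⟫ = uw at *
  generalize ⟪v, w⟫ = vw at *
  generalize ‖u‖ ^ 2 = p at *
  generalize ‖v‖ ^ 2 = q at *
  generalize ‖w‖ ^ 2 = r at *
  have hFE : F * E = E - 2 * κ * ((1 - 2 * κ * vw - κ * r) * uv + (1 + κ * q) * uw)
      + κ ^ 2 * p * (q + 2 * vw + r) := by
    rw [hF, huy, hy]; field_simp
  have habF : ab * (D * F) = (1 - 2 * κ * uv - κ * q) *
      ((1 - 2 * κ * uy - κ * yy) * p + (1 + κ * p) * uy) + (1 + κ * p) *
      ((1 - 2 * κ * uy - κ * yy) * uv + (1 + κ * p) * vy) := by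
    rw [hab]; field_simp
  have hbF : bb * F = p + 2 * uy + yy := by rw [hb]; field_simp
  have haD : aa * D = p + 2 * uv + q := by rw [ha]; field_simp
  have huyE := (eq_div_iff h₂).1 huy
  have hvyE := (eq_div_iff h₂).1 hvy
  have hyyE := (eq_div_iff h₂).1 hy
  clear hab hb ha huy hvy hy hF
  have hG : G * (D * F * E) = ((1 + κ * p) * (1 + κ * q)) ^ 2 := by
    have e : G * (D * F * E) = D * (F * E) + 2 * κ * (ab * (D * F)) * E
        + κ ^ 2 * (aa * D) * (bb * F) * E := by rw [hc]; ring
    rw [e, hFE, habF, hbF, haD]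
    have e2 : 2 * κ * ((1 - 2 * κ * uv - κ * q) *
        ((1 - 2 * κ * uy - κ * yy) * p + (1 + κ * p) * uy) + (1 + κ * p) *
        ((1 - 2 * κ * uy - κ * yy) * uv + (1 + κ * p) * vy)) * E
        + κ ^ 2 * (p + 2 * uv + q) * (p + 2 * uy + yy) * E =
        2 * κ * ((1 - 2 * κ * uv - κ * q) *
        ((E - 2 * κ * (uy * E) - κ * (yy * E)) * p + (1 + κ * p) * (uy * E)) + (1 + κ * p) *
        ((E - 2 * κ * (uy * E) - κ * (yy * E)) * uv + (1 + κ * p) * (vy * E)))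
        + κ ^ 2 * (p + 2 * uv + q) * (p * E + 2 * (uy * E) + yy * E) := by ring
    rw [add_assoc, e2, huyE, hvyE, hyyE, ← hD', hE']
    ring
  have hUV : (1 + κ * p) * (1 + κ * q) ≠ 0 := by
    intro h
    rw [h] at hG
    have : G * (D * F * E) ≠ 0 := by positivity
    simp [hG] at this
  have hc2 : (1 + κ * aa) * D = (1 + κ * p) * (1 + κ * q) := by
    linear_combination κ * haD - hD'
  have hc1 : (1 + 2 * κ * ab - κ * bb) * (D * F * E) = D * (F * E) + 2 * κ *
      ((1 - 2 * κ * uv - κ * q) *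
        ((E - 2 * κ * (uy * E) - κ * (yy * E)) * p + (1 + κ * p) * (uy * E)) + (1 + κ * p) *
        ((E - 2 * κ * (uy * E) - κ * (yy * E)) * uv + (1 + κ * p) * (vy * E)))
      - κ * D * (p * E + 2 * (uy * E) + yy * E) := by
    linear_combination 2 * κ * E * habF - κ * D * E * hbF
  have hd1 : (1 - 2 * κ * uy - κ * yy) * E = E - 2 * κ * (uy * E) - κ * (yy * E) := by ring
  rw [huyE, hvyE, hyyE, hFE] at hc1
  rw [huyE, hyyE] at hd1
  generalize 1 + 2 * κ * ab - κ * bb = c₁ at *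
  generalize 1 + κ * aa = c₂ at *
  generalize 1 - 2 * κ * uy - κ * yy = d₁ at *
  have hGi : G⁻¹ = D * F * E / ((1 + κ * p) * (1 + κ * q)) ^ 2 := by
    rw [← hG]; field_simp
  have hU : 1 + κ * p ≠ 0 := left_ne_zero_of_mul hUV
  have hV : 1 + κ * q ≠ 0 := right_ne_zero_of_mul hUV
  have hu : G⁻¹ * (-c₁ * (D⁻¹ * (1 - 2 * κ * uv - κ * q)) + c₂ * (F⁻¹ * d₁)) =
      2 / D * (-(κ ^ 2) * uw * q - κ * vw + 2 * κ ^ 2 * uv * vw) := by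
    have e : G⁻¹ * (-c₁ * (D⁻¹ * (1 - 2 * κ * uv - κ * q)) + c₂ * (F⁻¹ * d₁)) =
        (-(c₁ * (D * F * E)) * (1 - 2 * κ * uv - κ * q) + (c₂ * D) * (d₁ * E) * D)
          / (D * ((1 + κ * p) * (1 + κ * q)) ^ 2) := by
      rw [hGi]; field_simp
    rw [e, hc1, hc2, hd1, div_mul_eq_mul_div, div_eq_div_iff (by positivity) h₁,
      ← hD', hE']
    ring
  have hv : G⁻¹ * (-c₁ * (D⁻¹ * (1 + κ * p))
      + c₂ * (F⁻¹ * ((1 + κ * p) * (E⁻¹ * (1 - 2 * κ * vw - κ * r))))) =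
      2 / D * (-(κ ^ 2) * vw * p + κ * uw) := by
    have e : G⁻¹ * (-c₁ * (D⁻¹ * (1 + κ * p))
        + c₂ * (F⁻¹ * ((1 + κ * p) * (E⁻¹ * (1 - 2 * κ * vw - κ * r))))) =
        (-(c₁ * (D * F * E)) * (1 + κ * p)
          + (c₂ * D) * ((1 + κ * p) * (1 - 2 * κ * vw - κ * r)) * D)
          / (D * ((1 + κ * p) * (1 + κ * q)) ^ 2) := by
      rw [hGi]; field_simp
    rw [e, hc1, hc2, div_mul_eq_mul_div, div_eq_div_iff (by positivity) h₁, ← hD', hE']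
    ring
  have hw : G⁻¹ * (c₂ * (F⁻¹ * ((1 + κ * p) * (E⁻¹ * (1 + κ * q))))) = 1 := by
    have e : G⁻¹ * (c₂ * (F⁻¹ * ((1 + κ * p) * (E⁻¹ * (1 + κ * q))))) =
        (c₂ * D) / ((1 + κ * p) * (1 + κ * q)) := by
      rw [hGi]; field_simp
    rw [e, hc2, div_self hUV]
  rw [smul_add (2 / D), smul_smul (2 / D), smul_smul (2 / D), ← hu, ← hv]
  have hw₁ := one_smul ℝ w
  rw [← hw] at hw₁
  nth_rewrite 2 [← hw₁]
  module
end

section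
/- Gyrocommutativity: for u, v ∈ ℝ^n for which the κ-additions are defined, u ⊕_κ v = gyr[u,v](v ⊕_κ u), where gyr[u,v]w = -(u ⊕_κ v) ⊕_κ (u ⊕_κ (v ⊕_κ w)). -/
open scoped RealInnerProductSpace

open ComplexConjugate in
/-- Möbius addition in the complex plane. -/
noncomputable def complexKadd (κ : ℝ) (a b : ℂ) : ℂ :=
  (a + b) / (1 - κ * conj a * b)

/-- Any two vectors of a real inner product space can be modelled by complex numbers with the
same Gram matrix. -/
theorem exists_complex_gram_eq {E : Type*} [NormedAddCommGroup E] [InnerProductSpace ℝ E]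
    (u v : E) : ∃ a b : ℂ, ⟪a, a⟫ = ⟪u, u⟫ ∧ ⟪a, b⟫ = ⟪u, v⟫ ∧ ⟪b, b⟫ = ⟪v, v⟫ := by
  by_cases hu : u = 0
  · refine ⟨0, (‖v‖ : ℂ), by simp [hu], by simp [hu], ?_⟩
    rw [real_inner_self_eq_norm_sq, real_inner_self_eq_norm_sq]
    simp
  · have hu' : ‖u‖ ≠ 0 := norm_ne_zero_iff.mpr hu
    have hq : 0 ≤ ‖v‖ ^ 2 - (⟪u, v⟫ / ‖u‖) ^ 2 := by
      have h := abs_real_inner_le_norm u v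
      have h' : |⟪u, v⟫ / ‖u‖| ≤ |‖v‖| := by
        rw [abs_div, abs_norm, abs_norm, div_le_iff₀ (by positivity)]
        linarith
      linarith [sq_le_sq.mpr h']
    refine ⟨(‖u‖ : ℂ), ⟨⟪u, v⟫ / ‖u‖, √(‖v‖ ^ 2 - (⟪u, v⟫ / ‖u‖) ^ 2)⟩, ?_, ?_, ?_⟩
    · rw [real_inner_self_eq_norm_sq, real_inner_self_eq_norm_sq]
      simp
    · simp [Complex.inner]
      field_simp
    · rw [real_inner_self_eq_norm_sq v, Complex.inner]
      simp only [Complex.mul_re, Complex.conj_re, Complex.conj_im]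
      linarith [Real.mul_self_sqrt hq]

/-- Any two vectors lie in the domain of a real linear isometric relation with the complex
plane. -/
theorem exists_isometric_relation {E : Type*} [NormedAddCommGroup E] [InnerProductSpace ℝ E]
    (u v : E) : ∃ (R : Submodule ℝ (E × ℂ)) (a b : ℂ),
      (∀ p ∈ R, ‖p.1‖ = ‖p.2‖) ∧ (u, a) ∈ R ∧ (v, b) ∈ R := by
  obtain ⟨a, b, haa, hab, hbb⟩ := exists_complex_gram_eq u v
  refine ⟨Submodule.span ℝ {(u, a), (v, b)}, a, b, fun p hp => ?_,
    Submodule.subset_span (by simp), Submodule.subset_span (by simp)⟩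
  obtain ⟨s, t, rfl⟩ := Submodule.mem_span_pair.mp hp
  have hba : ⟪b, a⟫ = ⟪v, u⟫ := by rw [real_inner_comm, hab, real_inner_comm]
  rw [← sq_eq_sq₀ (norm_nonneg _) (norm_nonneg _), ← real_inner_self_eq_norm_sq,
    ← real_inner_self_eq_norm_sq]
  simp only [Prod.fst_add, Prod.snd_add, Prod.smul_fst, Prod.smul_snd, inner_add_left,
    inner_add_right, real_inner_smul_left, real_inner_smul_right, haa, hab, hba, hbb]

section IsometricRelation

variable {n : ℕ} {R : Submodule ℝ (EuclideanSpace ℝ (Fin n) × ℂ)}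
  {x y : EuclideanSpace ℝ (Fin n)} {a b : ℂ}

theorem inner_eq_of_mem (hR : ∀ p ∈ R, ‖p.1‖ = ‖p.2‖) (hx : (x, a) ∈ R) (hy : (y, b) ∈ R) :
    ⟪x, y⟫ = ⟪a, b⟫ := by
  have h : ‖x + y‖ = ‖a + b‖ := hR (x + y, a + b) (R.add_mem hx hy)
  have hx' : ‖x‖ = ‖a‖ := hR (x, a) hx
  have hy' : ‖y‖ = ‖b‖ := hR (y, b) hy
  rw [real_inner_eq_norm_add_mul_self_sub_norm_mul_self_sub_norm_mul_self_div_two,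
    real_inner_eq_norm_add_mul_self_sub_norm_mul_self_sub_norm_mul_self_div_two, h, hx', hy']

open ComplexConjugate in
theorem kdenom_eq_of_mem (κ : ℝ) (hR : ∀ p ∈ R, ‖p.1‖ = ‖p.2‖) (hx : (x, a) ∈ R)
    (hy : (y, b) ∈ R) :
    (kdenom κ x y : ℂ) = (1 - κ * conj a * b) * (1 - κ * a * conj b) := by
  have hx' : ‖x‖ = ‖a‖ := hR (x, a) hx
  have hy' : ‖y‖ = ‖b‖ := hR (y, b) hy
  rw [kdenom, inner_eq_of_mem hR hx hy, hx', hy', ← Complex.normSq_eq_norm_sq,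
    ← Complex.normSq_eq_norm_sq, Complex.inner]
  apply Complex.ext <;> simp [pow_two, Complex.normSq_apply] <;> ring

open ComplexConjugate in
theorem one_sub_ne_zero_of_kdenom_ne_zero {κ : ℝ} (hR : ∀ p ∈ R, ‖p.1‖ = ‖p.2‖)
    (hx : (x, a) ∈ R) (hy : (y, b) ∈ R) (h : kdenom κ x y ≠ 0) :
    1 - κ * conj a * b ≠ 0 := by
  have h' : (kdenom κ x y : ℂ) ≠ 0 := Complex.ofReal_ne_zero.mpr h
  rw [kdenom_eq_of_mem κ hR hx hy] at h'
  exact left_ne_zero_of_mul h'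

open ComplexConjugate in
theorem kadd_mem {κ : ℝ} (hR : ∀ p ∈ R, ‖p.1‖ = ‖p.2‖) (hx : (x, a) ∈ R) (hy : (y, b) ∈ R)
    (h : kdenom κ x y ≠ 0) : (kadd κ x y, complexKadd κ a b) ∈ R := by
  have hx' : ‖x‖ = ‖a‖ := hR (x, a) hx
  have hy' : ‖y‖ = ‖b‖ := hR (y, b) hy
  have hd : (kdenom κ x y : ℂ) ≠ 0 := Complex.ofReal_ne_zero.mpr h
  have key : complexKadd κ a b = (kdenom κ x y)⁻¹ •
      ((1 - 2 * κ * ⟪x, y⟫ - κ * ‖y‖ ^ 2) • a + (1 + κ * ‖x‖ ^ 2) • b) := by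
    have hnum : (1 - 2 * κ * ⟪x, y⟫ - κ * ‖y‖ ^ 2) • a + (1 + κ * ‖x‖ ^ 2) • b
        = (a + b) * (1 - κ * a * conj b) := by
      rw [inner_eq_of_mem hR hx hy, hx', hy', ← Complex.normSq_eq_norm_sq,
        ← Complex.normSq_eq_norm_sq, Complex.inner]
      apply Complex.ext <;> simp [Complex.normSq_apply] <;> ring
    rw [hnum, Complex.real_smul, Complex.ofReal_inv, complexKadd]
    rw [kdenom_eq_of_mem κ hR hx hy] at hd ⊢
    have h₁ := left_ne_zero_of_mul hd
    have h₂ := right_ne_zero_of_mul hd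
    rw [inv_mul_eq_div, mul_div_mul_right _ _ h₂]
  rw [key]
  exact R.smul_mem _ (R.add_mem (R.smul_mem _ hx) (R.smul_mem _ hy))

end IsometricRelation

open ComplexConjugate in
theorem complexKadd_gyrocomm (κ : ℝ) (a b : ℂ)
    (h₁ : 1 - κ * conj a * b ≠ 0)
    (h₂ : 1 - κ * conj b * a ≠ 0)
    (h₃ : 1 - κ * conj b * complexKadd κ b a ≠ 0)
    (h₄ : 1 - κ * conj a * complexKadd κ b (complexKadd κ b a) ≠ 0)
    (h₅ : 1 - κ * conj (-complexKadd κ a b) *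
      complexKadd κ a (complexKadd κ b (complexKadd κ b a)) ≠ 0) :
    complexKadd κ a b = complexKadd κ (-complexKadd κ a b)
      (complexKadd κ a (complexKadd κ b (complexKadd κ b a))) := by
  have hs : conj (complexKadd κ a b) = (conj a + conj b) / (1 - κ * conj b * a) := by
    simp only [complexKadd, map_div₀, map_add, map_sub, map_mul, map_one, Complex.conj_conj,
      Complex.conj_ofReal]
    ring
  set w := complexKadd κ b a with hw
  set z := complexKadd κ b w with hz
  set y := complexKadd κ a z with hy
  set s := complexKadd κ a b with hs'
  have hyz : y * ((1 - κ * conj a * b) * (1 - κ * conj b * a) -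
      κ * (a + b) * (conj a + conj b)) = 2 * (a + b) * (1 - κ * conj b * a) := by
    have hw' : w * (1 - κ * conj b * a) = b + a := by rw [hw, complexKadd, div_mul_cancel₀ _ h₂]
    have hz' : z * (1 - κ * conj b * w) = b + w := by rw [hz, complexKadd, div_mul_cancel₀ _ h₃]
    have hy' : y * (1 - κ * conj a * z) = a + z := by rw [hy, complexKadd, div_mul_cancel₀ _ h₄]
    have hzw : z * (1 - κ * conj b * a - κ * conj b * (a + b)) =
        b * (1 - κ * conj b * a) + a + b := by
      linear_combination (1 - κ * conj b * a) * hz' + (1 + κ * conj b * z) * hw'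
    linear_combination (1 - κ * conj b * a - κ * conj b * (a + b)) * hy' +
      (1 + κ * conj a * y) * hzw
  rw [complexKadd, eq_div_iff h₅, map_neg, hs, hs', complexKadd]
  generalize 1 - κ * conj a * b = d at h₁ hyz ⊢
  generalize 1 - κ * conj b * a = e at h₂ hyz ⊢
  field_simp
  linear_combination -hyz

/-- Gyrocommutativity: `u ⊕_κ v = gyr[u,v](v ⊕_κ u)`. -/
theorem kadd_gyrocomm {n : ℕ} (κ : ℝ) (u v : EuclideanSpace ℝ (Fin n))
    (h₁ : kdenom κ u v ≠ 0) (h₂ : kdenom κ v u ≠ 0)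
    (h₃ : kdenom κ v (kadd κ v u) ≠ 0)
    (h₄ : kdenom κ u (kadd κ v (kadd κ v u)) ≠ 0)
    (h₅ : kdenom κ (-(kadd κ u v)) (kadd κ u (kadd κ v (kadd κ v u))) ≠ 0) :
    kadd κ u v = kgyr κ u v (kadd κ v u) := by
  obtain ⟨R, a, b, hR, hu, hv⟩ := exists_isometric_relation u v
  have huv := kadd_mem hR hu hv h₁
  have hneg : (-kadd κ u v, -complexKadd κ a b) ∈ R := R.neg_mem huv
  have hvu := kadd_mem hR hv hu h₂
  have hvvu := kadd_mem hR hv hvu h₃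
  have huvvu := kadd_mem hR hu hvvu h₄
  have hgyr := kadd_mem hR hneg huvvu h₅
  have heq := complexKadd_gyrocomm κ a b
    (one_sub_ne_zero_of_kdenom_ne_zero hR hu hv h₁)
    (one_sub_ne_zero_of_kdenom_ne_zero hR hv hu h₂)
    (one_sub_ne_zero_of_kdenom_ne_zero hR hv hvu h₃)
    (one_sub_ne_zero_of_kdenom_ne_zero hR hu hvvu h₄)
    (one_sub_ne_zero_of_kdenom_ne_zero hR hneg huvvu h₅)
  have hdiff := hR _ (R.sub_mem huv hgyr)
  simp only [Prod.fst_sub, Prod.snd_sub, ← heq, sub_self, norm_zero, norm_eq_zero] at hdiff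
  exact sub_eq_zero.mp hdiff
end
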